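/- arXiv:1009.4244 — 3 statements merged into one kernel-verified Lean document; each statement's English description precedes it below -/
import Mathlib

section
/- Let m ≥ 2 and let K_{ij} : ℝ^m → ℝ be smooth functions with K_{ij} = K_{ji}. Then K satisfies the valence-two Killing tensor equation of Euclidean space, ∂_k K_{ij} + ∂_i K_{jk} + ∂_j K_{ki} = 0 identically on ℝ^m, if and only if there exist unique constants A_{ij}, B_{ijk}, C_{ijkl} with A_{ij} = A_{ji}, B_{ijk} = −B_{ikj}, B_{ijk} + B_{jki} + B_{kij} = 0, and C an algebraic curvature tensor on ℝ^m, such that K_{ij}(x) = A_{ij} + (B_{ijk} + B_{jik}) x_k + 4 C_{ikjl} x_k x_l for all x ∈ ℝ^m (repeated indices summed). -/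
/-- Partial derivative `∂f/∂xᵢ` of a scalar function on `ℝ^m` at `x`. -/
noncomputable def pd {m : ℕ} (f : (Fin m → ℝ) → ℝ) (i : Fin m) (x : Fin m → ℝ) : ℝ :=
  fderiv ℝ f x (Pi.single i 1)

/-- An algebraic curvature tensor on `ℝ^m`: skew in the first pair, symmetric under
exchange of pairs, and satisfying the first Bianchi identity. -/
def IsACT {m : ℕ} (C : Fin m → Fin m → Fin m → Fin m → ℝ) : Prop :=
  (∀ i j k l, C i j k l = - C j i k l) ∧
  (∀ i j k l, C i j k l = C k l i j) ∧
  (∀ i j k l, C i j k l + C i k l j + C i l j k = 0)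

theorem ContDiff.pd {m : ℕ} {f : (Fin m → ℝ) → ℝ} (hf : ContDiff ℝ (⊤ : ℕ∞) f) (i : Fin m) :
    ContDiff ℝ (⊤ : ℕ∞) (pd f i) :=
  (hf.fderiv_right (m := (⊤ : ℕ∞)) (by simp)).clm_apply contDiff_const

theorem ContDiff.differentiable_of_top {m : ℕ} {f : (Fin m → ℝ) → ℝ}
    (hf : ContDiff ℝ (⊤ : ℕ∞) f) : Differentiable ℝ f :=
  hf.differentiable (by simp)

/-- Partial derivatives of a smooth function commute. -/
theorem pd_pd_comm {m : ℕ} {f : (Fin m → ℝ) → ℝ} (hf : ContDiff ℝ (⊤ : ℕ∞) f) (i j : Fin m) :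
    pd (pd f i) j = pd (pd f j) i := by
  have hd : Differentiable ℝ (fderiv ℝ f) :=
    (hf.fderiv_right (m := (⊤ : ℕ∞)) (by simp)).differentiable (by simp)
  have key : ∀ (i j : Fin m) (x : Fin m → ℝ),
      pd (pd f i) j x = fderiv ℝ (fderiv ℝ f) x (Pi.single j 1) (Pi.single i 1) := by
    intro i j x
    have h := (hd x).hasFDerivAt.clm_apply
      (hasFDerivAt_const (Pi.single i (1 : ℝ) : Fin m → ℝ) x)
    change fderiv ℝ (fun y => fderiv ℝ f y (Pi.single i 1)) x _ = _
    rw [h.fderiv]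
    simp
  funext x
  rw [key, key]
  exact hf.contDiffAt.isSymmSndFDerivAt (by simpa using WithTop.coe_le_coe.2 (le_top : (2 : ℕ∞) ≤ ⊤)) _ _

theorem pd_add_add_eq_zero {m : ℕ} {f g h : (Fin m → ℝ) → ℝ} (hf : Differentiable ℝ f)
    (hg : Differentiable ℝ g) (hh : Differentiable ℝ h) (hsum : ∀ x, f x + g x + h x = 0)
    (p : Fin m) (x : Fin m → ℝ) : pd f p x + pd g p x + pd h p x = 0 := by
  have h1 := ((hf x).hasFDerivAt.add (hg x).hasFDerivAt).add (hh x).hasFDerivAt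
  have h0 : f + g + h = fun _ => 0 := funext hsum
  rw [h0] at h1
  have h2 := h1.unique (hasFDerivAt_const (0 : ℝ) x)
  simpa [pd] using DFunLike.congr_fun h2 (Pi.single p 1)

/-- A differentiable function is determined by its partial derivatives and its value at `0`. -/
theorem eq_of_pd_eq {m : ℕ} {f g : (Fin m → ℝ) → ℝ} (hf : Differentiable ℝ f)
    (hg : Differentiable ℝ g) (hpd : ∀ i x, pd f i x = pd g i x) (h0 : f 0 = g 0) : f = g := by
  refine eq_of_fderiv_eq hf hg (fun x => ?_) 0 h0
  refine ContinuousLinearMap.coe_injective (LinearMap.pi_ext' fun i => ?_)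
  ext
  exact hpd i x

/-- The quadratic polynomial `a + bₖ xₖ + qₖₗ xₖ xₗ`. -/
def quadPoly {m : ℕ} (a : ℝ) (b : Fin m → ℝ) (q : Fin m → Fin m → ℝ) (x : Fin m → ℝ) : ℝ :=
  a + (∑ k, b k * x k) + ∑ k, ∑ l, q k l * x k * x l

theorem differentiable_quadPoly {m : ℕ} (a : ℝ) (b : Fin m → ℝ) (q : Fin m → Fin m → ℝ) :
    Differentiable ℝ (quadPoly a b q) := by
  unfold quadPoly
  fun_prop

theorem quadPoly_zero {m : ℕ} (a : ℝ) (b : Fin m → ℝ) (q : Fin m → Fin m → ℝ) :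
    quadPoly a b q 0 = a := by
  simp [quadPoly]

theorem pd_quadPoly {m : ℕ} (a : ℝ) (b : Fin m → ℝ) (q : Fin m → Fin m → ℝ) (p : Fin m) :
    pd (quadPoly a b q) p = quadPoly (b p) (fun l => q p l + q l p) 0 := by
  funext x
  have hx : ∀ k : Fin m, HasFDerivAt (fun y : Fin m → ℝ => y k)
      (ContinuousLinearMap.proj (R := ℝ) (φ := fun _ : Fin m => ℝ) k) x :=
    fun k => hasFDerivAt_apply k x
  have h := ((HasFDerivAt.fun_sum (u := Finset.univ) fun k _ => (hx k).const_mul (b k)).const_add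
    a).add (HasFDerivAt.fun_sum (u := Finset.univ) fun k _ =>
      HasFDerivAt.fun_sum (u := Finset.univ) fun l _ => ((hx k).const_mul (q k l)).mul (hx l))
  have h' : HasFDerivAt (quadPoly a b q) _ x := h
  rw [pd, h'.fderiv]
  simp [quadPoly, Pi.single_apply, Finset.sum_add_distrib, add_mul]
  simp [mul_comm, add_comm]

theorem pd_pd_quadPoly {m : ℕ} (a : ℝ) (b : Fin m → ℝ) (q : Fin m → Fin m → ℝ) (k l : Fin m)
    (x : Fin m → ℝ) : pd (pd (quadPoly a b q) k) l x = q k l + q l k := by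
  rw [pd_quadPoly, pd_quadPoly]
  simp [quadPoly]

theorem quadPoly_injective {m : ℕ} {a a' : ℝ} {b b' : Fin m → ℝ} {q q' : Fin m → Fin m → ℝ}
    (h : quadPoly a b q = quadPoly a' b' q') :
    a = a' ∧ (∀ k, b k = b' k) ∧ ∀ k l, q k l + q l k = q' k l + q' l k := by
  refine ⟨?_, fun k => ?_, fun k l => ?_⟩
  · rw [← quadPoly_zero a b q, h, quadPoly_zero]
  · rw [← quadPoly_zero (b k) (fun l => q k l + q l k) 0, ← pd_quadPoly a, h, pd_quadPoly,
      quadPoly_zero]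
  · rw [← pd_pd_quadPoly a b q k l 0, h, pd_pd_quadPoly]

/-- Second-order Taylor expansion at `0` of a function whose third derivatives vanish. -/
theorem eq_quadPoly_of_pd_pd_pd_eq_zero {m : ℕ} {f : (Fin m → ℝ) → ℝ}
    (hf : ContDiff ℝ (⊤ : ℕ∞) f) (h3 : ∀ i j k x, pd (pd (pd f i) j) k x = 0) :
    f = quadPoly (f 0) (fun k => pd f k 0) (fun k l => pd (pd f k) l 0 / 2) := by
  refine eq_of_pd_eq hf.differentiable_of_top (differentiable_quadPoly _ _ _) (fun k => ?_)
    (quadPoly_zero _ _ _).symm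
  refine congrFun (eq_of_pd_eq (hf.pd k).differentiable_of_top ?_ (fun l => ?_) ?_)
  · rw [pd_quadPoly]
    exact differentiable_quadPoly _ _ _
  · refine congrFun (eq_of_pd_eq ((hf.pd k).pd l).differentiable_of_top ?_ (fun p x => ?_) ?_)
    · rw [pd_quadPoly, pd_quadPoly]
      exact differentiable_quadPoly _ _ _
    · rw [h3, pd_quadPoly, pd_pd_quadPoly]
      simp
    · rw [pd_pd_quadPoly, pd_pd_comm hf l k]
      ring
  · rw [pd_quadPoly, quadPoly_zero]

/-- An array symmetric in the first two and the last three indices, with vanishing cyclic sum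
over the first three, is zero. -/
theorem eq_zero_of_symm_of_cyclic {ι : Type*} {T : ι → ι → ι → ι → ι → ℝ}
    (h12 : ∀ i j k p q, T i j k p q = T j i k p q) (h34 : ∀ i j k p q, T i j k p q = T i j p k q)
    (h45 : ∀ i j k p q, T i j k p q = T i j k q p)
    (hc : ∀ i j k p q, T i j k p q + T j k i p q + T k i j p q = 0) (i j k p q : ι) :
    T i j k p q = 0 := by
  have e1 := hc i j k p q
  have e2 := hc i j p k q
  have e3 := hc i j q k p
  have e4 := hc i k p j q
  have e5 := hc i k q j p
  have e6 := hc i p q j k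
  have e7 := hc j k p i q
  have e8 := hc j k q i p
  have e9 := hc j p q i k
  have e10 := hc k p q i j
  simp only [h12, h34, h45] at e1 e2 e3 e4 e5 e6 e7 e8 e9 e10 ⊢
  linarith

theorem killing_pd_pd_pd_eq_zero {m : ℕ} {K : Fin m → Fin m → (Fin m → ℝ) → ℝ}
    (hsmooth : ∀ i j, ContDiff ℝ (⊤ : ℕ∞) (K i j)) (hsymm : ∀ i j, K i j = K j i)
    (hK : ∀ (x : Fin m → ℝ) (i j k : Fin m),
      pd (K i j) k x + pd (K j k) i x + pd (K k i) j x = 0)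
    (i j k p q : Fin m) (x : Fin m → ℝ) : pd (pd (pd (K i j) k) p) q x = 0 := by
  refine eq_zero_of_symm_of_cyclic (T := fun i j k p q => pd (pd (pd (K i j) k) p) q x)
    (fun i j k p q => ?_) (fun i j k p q => ?_) (fun i j k p q => ?_) (fun i j k p q => ?_)
    i j k p q
  · rw [hsymm i j]
  · rw [pd_pd_comm (hsmooth i j)]
  · rw [pd_pd_comm ((hsmooth i j).pd k)]
  · have hd : ∀ i j k, Differentiable ℝ (pd (K i j) k) :=
      fun i j k => ((hsmooth i j).pd k).differentiable_of_top
    have hd' : ∀ i j k p, Differentiable ℝ (pd (pd (K i j) k) p) :=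
      fun i j k p => (((hsmooth i j).pd k).pd p).differentiable_of_top
    exact pd_add_add_eq_zero (hd' _ _ _ _) (hd' _ _ _ _) (hd' _ _ _ _)
      (pd_add_add_eq_zero (hd _ _ _) (hd _ _ _) (hd _ _ _) (fun x => hK x i j k) p) q x

theorem eq_of_add_swap_eq {ι : Type*} {B B' : ι → ι → ι → ℝ}
    (h1 : ∀ i j k, B i j k = -B i k j) (h2 : ∀ i j k, B i j k + B j k i + B k i j = 0)
    (h1' : ∀ i j k, B' i j k = -B' i k j) (h2' : ∀ i j k, B' i j k + B' j k i + B' k i j = 0)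
    (h : ∀ i j k, B i j k + B j i k = B' i j k + B' j i k) : B = B' := by
  funext i j k
  linarith [h i j k, h i k j, h1 i j k, h1 j i k, h2 i j k, h1' i j k, h1' j i k, h2' i j k]

/-- An algebraic curvature tensor is determined by its symmetrization over the second and fourth
indices. -/
theorem IsACT.eq_of_add_swap_eq {m : ℕ} {C C' : Fin m → Fin m → Fin m → Fin m → ℝ}
    (hC : IsACT C) (hC' : IsACT C')
    (h : ∀ i j k l, C i k j l + C i l j k = C' i k j l + C' i l j k) : C = C' := by
  obtain ⟨h1, h2, h3⟩ := hC
  obtain ⟨h1', h2', h3'⟩ := hC'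
  funext a b c d
  linarith [h a c b d, h b c a d, h1 a b c d, h2 a d c b, h1 c b a d, h2 b c a d, h1 a d b c,
    h2 d a b c, h3 b a c d, h2 b d a c, h1 a c b d, h2 c a b d, h1' a b c d, h2' a d c b,
    h1' c b a d, h2' b c a d, h1' a d b c, h2' d a b c, h3' b a c d, h2' b d a c, h1' a c b d,
    h2' c a b d]

/-- An array symmetric in each index pair, with vanishing cyclic sum over the first three indices,
is invariant under exchange of the pairs. -/
theorem pair_symm_of_cyclic {ι : Type*} {Q : ι → ι → ι → ι → ℝ}
    (h12 : ∀ i j k l, Q i j k l = Q j i k l) (h34 : ∀ i j k l, Q i j k l = Q i j l k)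
    (hc : ∀ i j k l, Q i j k l + Q j k i l + Q k i j l = 0) (i j k l : ι) :
    Q i j k l = Q k l i j := by
  grind

/-- A smooth symmetric tensor field `K_{ij}` on `ℝ^m` satisfies the valence-two Killing
tensor equation `∂ₖK_{ij} + ∂ᵢK_{jk} + ∂ⱼK_{ki} = 0` iff there exist unique constants
`A_{ij}`, `B_{ijk}`, `C_{ijkl}` with the stated symmetries (with `C` an algebraic
curvature tensor) such that `K_{ij}(x) = A_{ij} + (B_{ijk} + B_{jik}) xₖ + 4 C_{ikjl} xₖ xₗ`. -/
theorem killing_tensor_general_form {m : ℕ} (hm : 2 ≤ m)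
    (K : Fin m → Fin m → (Fin m → ℝ) → ℝ)
    (hsmooth : ∀ i j, ContDiff ℝ (⊤ : ℕ∞) (K i j))
    (hsymm : ∀ i j, K i j = K j i) :
    (∀ (x : Fin m → ℝ) (i j k : Fin m),
        pd (K i j) k x + pd (K j k) i x + pd (K k i) j x = 0) ↔
    (∃! ABC : (Fin m → Fin m → ℝ) × (Fin m → Fin m → Fin m → ℝ) ×
              (Fin m → Fin m → Fin m → Fin m → ℝ),
        (∀ i j, ABC.1 i j = ABC.1 j i) ∧
        (∀ i j k, ABC.2.1 i j k = - ABC.2.1 i k j) ∧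
        (∀ i j k, ABC.2.1 i j k + ABC.2.1 j k i + ABC.2.1 k i j = 0) ∧
        IsACT ABC.2.2 ∧
        (∀ (x : Fin m → ℝ) (i j : Fin m),
          K i j x = ABC.1 i j + (∑ k, (ABC.2.1 i j k + ABC.2.1 j i k) * x k)
            + 4 * ∑ k, ∑ l, ABC.2.2 i k j l * x k * x l)) := by
  have hquad : ∀ (A : Fin m → Fin m → ℝ) (B : Fin m → Fin m → Fin m → ℝ)
      (C : Fin m → Fin m → Fin m → Fin m → ℝ),
      (∀ (x : Fin m → ℝ) (i j : Fin m),
        K i j x = A i j + (∑ k, (B i j k + B j i k) * x k)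
          + 4 * ∑ k, ∑ l, C i k j l * x k * x l) ↔
      ∀ i j, K i j = quadPoly (A i j) (fun k => B i j k + B j i k)
        (fun k l => 4 * C i k j l) := by
    intro A B C
    simp only [funext_iff, quadPoly, Finset.mul_sum, mul_assoc]
    exact ⟨fun h i j x => h x i j, fun h x i j => h i j x⟩
  simp only [hquad]
  constructor
  · intro hK
    have hd : ∀ i j k, Differentiable ℝ (pd (K i j) k) :=
      fun i j k => ((hsmooth i j).pd k).differentiable_of_top
    have htaylor : ∀ i j, K i j = quadPoly (K i j 0) (fun k => pd (K i j) k 0)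
        (fun k l => pd (pd (K i j) k) l 0 / 2) := fun i j =>
      eq_quadPoly_of_pd_pd_pd_eq_zero (hsmooth i j) fun k p q x =>
        killing_pd_pd_pd_eq_zero hsmooth hsymm hK i j k p q x
    obtain ⟨L, hL⟩ : ∃ L : Fin m → Fin m → Fin m → ℝ, ∀ i j k, L i j k = pd (K i j) k 0 :=
      ⟨_, fun _ _ _ => rfl⟩
    obtain ⟨Q, hQ⟩ : ∃ Q : Fin m → Fin m → Fin m → Fin m → ℝ,
        ∀ i j k l, Q i j k l = pd (pd (K i j) k) l 0 / 2 := ⟨_, fun _ _ _ _ => rfl⟩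
    simp only [← hL, ← hQ] at htaylor
    have hL12 : ∀ i j k, L i j k = L j i k := fun i j k => by rw [hL, hL, hsymm i j]
    have hLc : ∀ i j k, L i j k + L j k i + L k i j = 0 := fun i j k => by
      rw [hL, hL, hL, hK]
    have hQ12 : ∀ i j k l, Q i j k l = Q j i k l := fun i j k l => by
      rw [hQ, hQ, hsymm i j]
    have hQ34 : ∀ i j k l, Q i j k l = Q i j l k := fun i j k l => by
      rw [hQ, hQ, pd_pd_comm (hsmooth i j)]
    have hQc : ∀ i j k l, Q i j k l + Q j k i l + Q k i j l = 0 := fun i j k l => by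
      have := pd_add_add_eq_zero (hd i j k) (hd j k i) (hd k i j) (fun x => hK x i j k) l 0
      rw [hQ, hQ, hQ]
      linarith
    have hQp := pair_symm_of_cyclic hQ12 hQ34 hQc
    refine existsUnique_of_exists_of_unique ⟨(fun i j => K i j 0, fun i j k => (L i j k - L i k j) / 3,
      fun a b c d => (Q a c b d - Q b c a d) / 6),
      ⟨fun i j => by simp only [hsymm i j], fun i j k => by ring, fun i j k => ?_,
        ⟨fun i j k l => by ring, fun i j k l => ?_, fun i j k l => ?_⟩, fun i j => ?_⟩⟩ ?_
    · linarith [hL12 i j k, hL12 j k i, hL12 k i j]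
    · linarith [hQ12 i k j l, hQ12 j k i l, hQ34 k i l j, hQp j k i l, hQ34 i l j k, hQ12 i l k j]
    · linarith [hQ12 i k j l, hQ12 j k i l, hQ12 k l i j, hQ12 i l j k, hQp i k j l, hQp j k i l,
        hQp i l j k, hQp i j k l, hQ34 i k j l, hQ34 i j k l, hQ34 i l j k, hQ34 j l i k,
        hQ34 k l i j, hQ12 i j k l, hQ12 l j i k, hQ34 l j i k, hQ34 k j i l, hQp i j l k]
    · refine (htaylor i j).trans (eq_of_pd_eq (differentiable_quadPoly _ _ _)
        (differentiable_quadPoly _ _ _) (fun k x => ?_) (by simp only [quadPoly_zero]))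
      rw [pd_quadPoly, pd_quadPoly]
      congr 1
      · linarith [hL12 i j k, hL12 k i j, hLc i j k]
      · funext l
        linarith [hQ34 i j k l, hQ12 j k i l, hQc i j k l, hQp i l j k, hQp j l i k, hQ12 k i j l,
          hQ34 k j i l, hQ12 l j i k, hQ34 i k j l, hQp l j i k, hQp k j i l, hQ34 i l j k,
          hQ34 i k l j, hQ12 i k j l]
    · rintro ⟨A, B, C⟩ ⟨A', B', C'⟩ ⟨-, hB1, hB2, hC, h⟩ ⟨-, hB1', hB2', hC', h'⟩
      have heq := fun i j => quadPoly_injective ((h i j).symm.trans (h' i j))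
      refine Prod.ext (funext fun i => funext fun j => (heq i j).1) (Prod.ext
        (eq_of_add_swap_eq hB1 hB2 hB1' hB2' fun i j => (heq i j).2.1)
        (hC.eq_of_add_swap_eq hC' fun i j k l => ?_))
      have := (heq i j).2.2 k l
      simp only at this
      linarith
  · rintro ⟨⟨A, B, C⟩, ⟨-, hB1, hB2, ⟨hC1, hC2, hC3⟩, hABC⟩, -⟩ x i j k
    simp only at hB1 hB2 hC1 hC2 hC3 hABC
    simp only [hABC, pd_quadPoly]
    simp only [quadPoly, Pi.zero_apply, zero_mul, Finset.sum_const_zero, add_zero]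
    have hsum : (∑ l, (4 * C i k j l + 4 * C i l j k) * x l) +
        (∑ l, (4 * C j i k l + 4 * C j l k i) * x l) +
        (∑ l, (4 * C k j i l + 4 * C k l i j) * x l) = 0 := by
      rw [← Finset.sum_add_distrib, ← Finset.sum_add_distrib]
      refine Finset.sum_eq_zero fun l _ => ?_
      have : C i k j l + C i l j k + C j i k l + C j l k i + C k j i l + C k l i j = 0 := by
        linarith [hC1 i k j l, hC2 i l j k, hC2 j l k i, hC2 k l i j, hC1 k i j l, hC1 j k i l,
          hC1 i j k l]
      linear_combination 4 * x l * this
    linarith [hB1 i j k, hB1 j k i, hB1 k i j, hB2 i j k]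
end

section
/- Let m ≥ 2, let C be an algebraic curvature tensor on ℝ^m, let K^{ij}(x) = 4 C_{ikjl} x_k x_l, and let the Casimir tensor be 𝒞^{ij}(x) = κ ( δ^{ij} Σ_a x_a x_a − x^i x^j ) for a constant κ ∈ ℝ. Then the Schouten bracket of 𝒞 and K vanishes identically: [𝒞, K]^{ijk}(x) = 0 for all x ∈ ℝ^m and all i,j,k. -/
/-- Sum over all permutations of the three indices. -/
noncomputable def sym3 {α : Type*} (F : α → α → α → ℝ) (i j k : α) : ℝ :=
  F i j k + F i k j + F j i k + F j k i + F k i j + F k j i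

open Finset in
/-- Partial derivatives of a quadratic form. -/
theorem pd_quadratic {m : ℕ} (A : Fin m → Fin m → ℝ) (c : ℝ) (l : Fin m) (x : Fin m → ℝ) :
    pd (fun y => c * ∑ a, ∑ b, A a b * y a * y b) l x =
      c * ((∑ b, A l b * x b) + ∑ a, A a l * x a) := by
  have hp : ∀ a, HasFDerivAt (fun y : Fin m → ℝ => y a)
      (ContinuousLinearMap.proj a : (Fin m → ℝ) →L[ℝ] ℝ) x := fun a => hasFDerivAt_apply a x
  have h := (HasFDerivAt.fun_sum (u := univ) fun a _ =>
    HasFDerivAt.fun_sum (u := univ) fun b _ =>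
      ((hp a).const_mul (A a b)).fun_mul (hp b)).const_mul c
  unfold pd
  rw [h.fderiv]
  simp [Pi.single_apply, sum_add_distrib, mul_add, mul_comm, add_comm]

open Finset in
/-- Partial derivatives of the components of the Casimir tensor. -/
theorem pd_casimir {m : ℕ} (κ d : ℝ) (j k l : Fin m) (x : Fin m → ℝ) :
    pd (fun y => κ * (d * (∑ a, y a * y a) - y j * y k)) l x =
      κ * (2 * d * x l - (if j = l then x k else 0) - (if k = l then x j else 0)) := by
  have hp : ∀ a, HasFDerivAt (fun y : Fin m → ℝ => y a)
      (ContinuousLinearMap.proj a : (Fin m → ℝ) →L[ℝ] ℝ) x := fun a => hasFDerivAt_apply a x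
  have h := (((HasFDerivAt.fun_sum (u := univ) fun a _ => (hp a).fun_mul (hp a)).const_mul d).fun_sub
    ((hp j).fun_mul (hp k))).const_mul κ
  unfold pd
  rw [h.fderiv]
  simp only [smul_apply, sub_apply,
    add_apply, _root_.sum_apply, ContinuousLinearMap.proj_apply,
    smul_eq_mul, Pi.single_apply, sum_add_distrib, mul_ite, mul_one, mul_zero, sum_ite_eq',
    mem_univ, if_true]
  split_ifs <;> ring

open Finset in
/-- The Schouten bracket of the Casimir tensor
`𝒞^{ij}(x) = κ (δ^{ij} Σₐ xₐ xₐ − x^i x^j)` with the spherical Killing tensor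
`K^{ij}(x) = 4 C_{ikjl} xₖ xₗ` vanishes identically, where the Schouten bracket of
symmetric two-tensors `P, Q` is `[P,Q]^{ijk} = Sym_{(i,j,k)} Σₗ (P^{ℓi} ∂ₗ Q^{jk} − Q^{ℓi} ∂ₗ P^{jk})`. -/
theorem casimir_commutes_with_spherical_KT {m : ℕ} (hm : 2 ≤ m)
    (C : Fin m → Fin m → Fin m → Fin m → ℝ) (hC : IsACT C) (κ : ℝ)
    (K Cas : (Fin m → ℝ) → Fin m → Fin m → ℝ)
    (hK : ∀ x i j, K x i j = 4 * ∑ k, ∑ l, C i k j l * x k * x l)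
    (hCas : ∀ x i j, Cas x i j =
      κ * ((if i = j then (1:ℝ) else 0) * (∑ a, x a * x a) - x i * x j)) :
    ∀ (x : Fin m → ℝ) (i j k : Fin m),
      sym3 (fun i' j' k' => ∑ l, (Cas x l i' * pd (fun y => K y j' k') l x
        - K x l i' * pd (fun y => Cas y j' k') l x)) i j k = 0 := by
  obtain ⟨hanti, hpair, -⟩ := hC
  intro x i j k
  let D : Fin m → Fin m → Fin m → ℝ := fun a b c => ∑ d, C a b c d * x d
  have hD : ∀ a b c, D a b c = - D b a c := fun a b c => by
    simp only [D, ← sum_neg_distrib]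
    exact sum_congr rfl fun d _ => by rw [hanti]; ring
  have hpdK : ∀ a b l, pd (fun y => K y a b) l x = 4 * (D a l b + D b l a) := fun a b l => by
    simp only [hK, pd_quadratic (fun k l => C a k b l), D]
    congr 2
    exact sum_congr rfl fun d _ => by rw [hpair]
  have hKD : ∀ a b, K x a b = 4 * ∑ l, x l * D a l b := fun a b => by
    rw [hK]
    simp only [D, mul_sum]
    exact sum_congr rfl fun c _ => sum_congr rfl fun d _ => by ring
  have hKsymm : ∀ a b, K x a b = K x b a := fun a b => by
    rw [hK, hK, sum_comm]
    congr 1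
    exact sum_congr rfl fun c _ => sum_congr rfl fun d _ => by rw [hpair]; ring
  have hKx : ∀ b, ∑ l, K x l b * x l = 0 := fun b => by
    have h : ∑ l, K x l b * x l = - ∑ l, K x l b * x l := by
      simp only [hKD, mul_sum, sum_mul]
      conv_lhs => rw [sum_comm]
      simp only [← sum_neg_distrib]
      exact sum_congr rfl fun c _ => sum_congr rfl fun d _ => by rw [hD d c]; ring
    linarith
  have hEuler : ∀ a b, ∑ l, x l * pd (fun y => K y a b) l x = 2 * K x a b := fun a b => by
    have h : ∑ l, x l * pd (fun y => K y a b) l x = K x a b + K x b a := by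
      rw [hKD, hKD, ← mul_add, ← sum_add_distrib, mul_sum]
      exact sum_congr rfl fun l _ => by rw [hpdK]; ring
    rw [h, hKsymm b a]; ring
  have hbracket : ∀ a b c, ∑ l, (Cas x l a * pd (fun y => K y b c) l x
      - K x l a * pd (fun y => Cas y b c) l x) =
      κ * ((∑ a, x a * x a) * (4 * (D b a c + D c a b)) - 2 * x a * K x b c
        + K x b a * x c + K x c a * x b) := fun a b c => by
    have hterm : ∀ l, Cas x l a * pd (fun y => K y b c) l x
        - K x l a * pd (fun y => Cas y b c) l x =
        κ * ((if l = a then (∑ a, x a * x a) * pd (fun y => K y b c) l x else 0)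
          - x a * (x l * pd (fun y => K y b c) l x)
          - 2 * (if b = c then 1 else 0) * (K x l a * x l)
          + (if b = l then K x l a * x c else 0)
          + (if c = l then K x l a * x b else 0)) := fun l => by
      simp only [hCas, pd_casimir]
      split_ifs <;> ring
    rw [sum_congr rfl fun l _ => hterm l, ← mul_sum]
    simp only [← mul_sum, sum_add_distrib, sum_sub_distrib, hEuler, hKx, sum_ite_eq,
      sum_ite_eq', mem_univ, if_true]
    rw [hpdK]
    ring
  simp only [sym3, hbracket]
  rw [hKsymm j i, hKsymm k i, hKsymm k j, hD j i k, hD k i j, hD k j i]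
  ring
end

section
/- Let m ≥ 2 and define on ℝ^m the translational vector fields X_i with components (X_i)^a = δ^a_i and the rotational vector fields R_{ij} with components (R_{ij})^a(x) = δ^a_i x_j − δ^a_j x_i. Then for all x ∈ ℝ^m, all indices, and all a,b ∈ {1,…,m}, the following syzygies among symmetrized products hold: Alt_{[i,j,k]} ( (X_i)^a (R_{jk})^b + (X_i)^b (R_{jk})^a ) = 0, and Alt_{[j,k,l]} ( (R_{ij})^a (R_{kl})^b + (R_{ij})^b (R_{kl})^a ) = 0; that is, X_{[i} ⊙ R_{jk]} = 0 and R_{i[j} ⊙ R_{kl]} = 0. -/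
/-- Signed sum over all permutations of the three indices. -/
noncomputable def alt3 {α : Type*} (F : α → α → α → ℝ) (i j k : α) : ℝ :=
  F i j k - F i k j - F j i k + F j k i + F k i j - F k j i

/-- The `a`-th component of the translational vector field `Xᵢ = ∂/∂xᵢ` on `ℝ^m`. -/
noncomputable def Xv {m : ℕ} (i a : Fin m) : ℝ :=
  if a = i then 1 else 0

/-- The `a`-th component of the rotational vector field `R_{ij}` on `ℝ^m`,
`(R_{ij})^a(x) = δ^a_i x_j − δ^a_j x_i`. -/
noncomputable def Rv {m : ℕ} (i j a : Fin m) (x : Fin m → ℝ) : ℝ :=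
  (if a = i then 1 else 0) * x j - (if a = j then 1 else 0) * x i

/-- The syzygies `X_{[i} ⊙ R_{jk]} = 0` and `R_{i[j} ⊙ R_{kl]} = 0` among symmetrized
products of the translational and rotational Killing vector fields of `ℝ^m`. -/
theorem killing_vector_syzygies {m : ℕ} (hm : 2 ≤ m) (x : Fin m → ℝ)
    (a b i j k l : Fin m) :
    alt3 (fun i' j' k' => Xv i' a * Rv j' k' b x + Xv i' b * Rv j' k' a x) i j k = 0 ∧
    alt3 (fun j' k' l' => Rv i j' a x * Rv k' l' b x + Rv i j' b x * Rv k' l' a x) j k l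
      = 0 := by
  constructor <;> simp only [alt3, Xv, Rv] <;> ring
end
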